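/- arXiv:1505.03257 — 3 statements merged into one kernel-verified Lean document; each statement's English description precedes it below -/
import Mathlib

section
/- Let (Y,X) and (Y',X') be two independent copies of the pair from the model. Then the matrix E[(Y−Y')²(X−X')(X−X')ᵀ] equals 4φ(f)·β*(β*)ᵀ + 4(1−μ₀²)·I_p, where I_p is the p×p identity matrix. In particular, if φ(f) > 0 then β* is the leading eigenvector of this matrix, with eigengap 4φ(f). -/
open MeasureTheory ProbabilityTheory

/-- The Gaussian moments `μ_k = E[f(Z) Z^k]` for `Z ~ N(0,1)`. -/
noncomputable def gaussMoment (f : ℝ → ℝ) (k : ℕ) : ℝ :=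
  ∫ z, f z * z ^ k ∂(gaussianReal 0 1)

/-- `φ(f) = μ₁² − μ₀μ₂ + μ₀²`. -/
noncomputable def phiFun (f : ℝ → ℝ) : ℝ :=
  gaussMoment f 1 ^ 2 - gaussMoment f 0 * gaussMoment f 2 + gaussMoment f 0 ^ 2


lemma basic_gauss {Ω : Type*} [MeasurableSpace Ω] (μ : Measure Ω) [IsProbabilityMeasure μ]
    (p : ℕ) (X : Ω → Fin p → ℝ) (hXm : Measurable X)
    (hXlaw : Measure.map X μ = Measure.pi fun _ : Fin p => gaussianReal 0 1) :
    HasGaussianLaw X μ ∧ (∀ i, ∫ ω, X ω i ∂μ = 0) ∧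
      (∀ i j, ∫ ω, X ω i * X ω j ∂μ = if i = j then 1 else 0) := by
  have hm : ∀ i, Measurable fun ω => X ω i := fun i => measurable_pi_iff.1 hXm i
  have hc : ∀ i, Measure.map (fun ω => X ω i) μ = gaussianReal 0 1 := by
    intro i
    have h := (measurePreserving_eval (fun _ : Fin p => gaussianReal 0 1) i).map_eq
    rw [← hXlaw, Measure.map_map (measurable_pi_apply i) hXm] at h
    exact h
  have hind : iIndepFun (fun i ω => X ω i) μ := by
    rw [iIndepFun_iff_map_fun_eq_pi_map (fun i => (hm i).aemeasurable)]
    simp_rw [hc]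
    exact hXlaw
  have hg : ∀ i, HasGaussianLaw (fun ω => X ω i) μ := fun i =>
    ⟨by rw [hc i]; infer_instance⟩
  have h1 : ∀ i, ∫ ω, X ω i ∂μ = 0 := by
    intro i
    have := integral_map (μ := μ) (hm i).aemeasurable (f := fun x : ℝ => x) (by fun_prop)
    rw [← this, hc i, integral_id_gaussianReal]
  refine ⟨hind.hasGaussianLaw hg, h1, ?_⟩
  intro i j
  split_ifs with hij
  · subst hij
    have := integral_map (μ := μ) (hm i).aemeasurable (f := fun x : ℝ => x * x) (by fun_prop)
    rw [← this, hc i]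
    have hv := variance_fun_id_gaussianReal (μ := 0) (v := 1)
    rw [variance_eq_integral (by fun_prop), integral_id_gaussianReal] at hv
    simpa [pow_two] using hv
  · have := (hind.indepFun hij).integral_fun_mul_eq_mul_integral (hm i).aestronglyMeasurable (hm j).aestronglyMeasurable
    rw [this, h1, h1, zero_mul]

lemma gauss_moments {Ω : Type*} [MeasurableSpace Ω] (μ : Measure Ω) [IsProbabilityMeasure μ]
    (p : ℕ) (β : Fin p → ℝ) (hβ : ∑ i, β i ^ 2 = 1)
    (f : ℝ → ℝ) (hfm : Measurable f) (hfb : ∀ z, f z ∈ Set.Icc (-1 : ℝ) 1)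
    (X : Ω → Fin p → ℝ) (hXm : Measurable X)
    (hXlaw : Measure.map X μ = Measure.pi fun _ : Fin p => gaussianReal 0 1) :
    (∫ ω, f (∑ i, X ω i * β i) ∂μ = gaussMoment f 0) ∧
    (∀ i, ∫ ω, f (∑ i, X ω i * β i) * X ω i ∂μ = gaussMoment f 1 * β i) ∧
    (∀ i j, ∫ ω, f (∑ i, X ω i * β i) * (X ω i * X ω j) ∂μ
      = gaussMoment f 0 * (if i = j then 1 else 0)
        + (gaussMoment f 2 - gaussMoment f 0) * (β i * β j)) := by
  obtain ⟨hG, h1, h2⟩ := basic_gauss μ p X hXm hXlaw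
  have hm : ∀ i, Measurable fun ω => X ω i := fun i => measurable_pi_iff.1 hXm i
  have hL : ∀ i, MemLp (fun ω => X ω i) 2 μ := fun i =>
    (HasGaussianLaw.eval (X := fun i ω => X ω i) hG i).memLp_two
  have hI : ∀ i, Integrable (fun ω => X ω i) μ := fun i => (hL i).integrable (by norm_num)
  have hII : ∀ i j, Integrable (fun ω => X ω i * X ω j) μ := fun i j => (hL i).integrable_mul (hL j)
  set W : Ω → ℝ := fun ω => ∑ i, X ω i * β i with hW
  have hWm : Measurable W := by fun_prop
  have hWL : MemLp W 2 μ := memLp_finsetSum _ (fun i _ => (hL i).mul_const (β i))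
  have hW1 : ∫ ω, W ω ∂μ = 0 := by
    simp only [hW]
    rw [integral_finsetSum _ (fun i _ => (hI i).mul_const _)]
    simp [integral_mul_const, h1]
  have hXW : ∀ i, ∫ ω, X ω i * W ω ∂μ = β i := by
    intro i
    have : ∀ ω, X ω i * W ω = ∑ j, (X ω i * X ω j) * β j := by
      intro ω; simp only [hW, Finset.mul_sum, mul_assoc]
    simp_rw [this]
    rw [integral_finsetSum _ (fun j _ => (hII i j).mul_const _)]
    simp [integral_mul_const, h2]
  have hXWI : ∀ i, Integrable (fun ω => X ω i * W ω) μ := fun i => (hL i).integrable_mul hWL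
  have hWWI : Integrable (fun ω => W ω * W ω) μ := hWL.integrable_mul hWL
  have hWW : ∫ ω, W ω * W ω ∂μ = 1 := by
    have : ∀ ω, W ω * W ω = ∑ j, (X ω j * W ω) * β j := by
      intro ω
      have : W ω = ∑ j, X ω j * β j := rfl
      conv_lhs => enter [1]; rw [this]
      rw [Finset.sum_mul]
      exact Finset.sum_congr rfl fun j _ => by ring
    simp_rw [this]
    rw [integral_finsetSum _ (fun j _ => (hXWI j).mul_const _)]
    simp only [integral_mul_const, hXW]
    rw [← hβ]
    exact Finset.sum_congr rfl fun j _ => by ring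
  set R : Fin p → Ω → ℝ := fun i ω => X ω i - β i * W ω with hR
  have hRm : ∀ i, Measurable (R i) := fun i => by fun_prop
  have hRL : ∀ i, MemLp (R i) 2 μ := fun i => (hL i).sub (hWL.const_mul (β i))
  have hRI : ∀ i, Integrable (R i) μ := fun i => (hRL i).integrable (by norm_num)
  have hRRI : ∀ i j, Integrable (fun ω => R i ω * R j ω) μ :=
    fun i j => (hRL i).integrable_mul (hRL j)
  have hWI : Integrable W μ := hWL.integrable (by norm_num)
  have hR1 : ∀ i, ∫ ω, R i ω ∂μ = 0 := by
    intro i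
    simp only [hR]
    rw [integral_sub (hI i) (hWI.const_mul _), integral_const_mul, h1, hW1]; ring
  have hRW : ∀ i, ∫ ω, R i ω * W ω ∂μ = 0 := by
    intro i
    have : ∀ ω, R i ω * W ω = X ω i * W ω - β i * (W ω * W ω) := by
      intro ω; simp only [hR]; ring
    simp_rw [this]
    rw [integral_sub (hXWI i) (hWWI.const_mul _), integral_const_mul, hXW, hWW]; ring
  have hRR : ∀ i j, ∫ ω, R i ω * R j ω ∂μ = (if i = j then 1 else 0) - β i * β j := by
    intro i j
    have : ∀ ω, R i ω * R j ω = X ω i * X ω j - β j * (X ω i * W ω) - β i * (R j ω * W ω) := by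
      intro ω; simp only [hR]; ring
    simp_rw [this]
    have hRWI : Integrable (fun ω => R j ω * W ω) μ := (hRL j).integrable_mul hWL
    rw [integral_sub ((hII i j).sub' ((hXWI i).const_mul _)) (hRWI.const_mul _),
      integral_sub (hII i j) ((hXWI i).const_mul _), integral_const_mul, integral_const_mul,
      hXW, hRW, h2]; ring
  let LW : (Fin p → ℝ) →L[ℝ] ℝ := ∑ i, β i • ContinuousLinearMap.proj (R := ℝ) i
  have hLW : ∀ ω, LW (X ω) = W ω := by
    intro ω; simp [LW, hW, mul_comm]
  let LR : (Fin p → ℝ) →L[ℝ] (Fin p → ℝ) :=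
    ContinuousLinearMap.pi fun i => ContinuousLinearMap.proj (R := ℝ) i - β i • LW
  have hLR : ∀ ω i, LR (X ω) i = R i ω := by
    intro ω i; simp [LR, hR, hLW]
  have hWG : HasGaussianLaw W μ := by
    have := hG.map_fun LW
    simpa only [hLW] using this
  have hWlaw : μ.map W = gaussianReal 0 1 := by
    rw [hWG.map_eq_gaussianReal, hW1, variance_eq_integral hWm.aemeasurable, hW1]
    simp [pow_two, hWW]
  have hind0 : IndepFun (fun ω i => R i ω) (fun ω (_ : Unit) => W ω) μ := by
    apply HasGaussianLaw.indepFun_of_covariance_eval (Y := fun _ => W)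
    · have := hG.map_fun (LR.prod (ContinuousLinearMap.pi fun _ : Unit => LW))
      have e : (fun ω => (LR.prod (ContinuousLinearMap.pi fun _ : Unit => LW)) (X ω))
          = fun ω => (fun i => R i ω, fun _ => W ω) := by
        funext ω
        refine Prod.ext (funext fun i => ?_) (funext fun _ => ?_)
        · exact hLR ω i
        · exact hLW ω
      rw [e] at this
      exact this
    · intro i _
      rw [covariance_eq_sub (hRL i) hWL, hW1]
      simp [hRW]
  -- products with a function of W
  have key : ∀ (g : ℝ → ℝ) (r : (Fin p → ℝ) → ℝ), Measurable g → Measurable r →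
      ∫ ω, g (W ω) * r (fun i => R i ω) ∂μ
        = (∫ z, g z ∂(gaussianReal 0 1)) * ∫ ω, r (fun i => R i ω) ∂μ := by
    intro g r hg hr
    have hi := hind0.symm.comp (φ := fun w : Unit → ℝ => g (w ())) (ψ := r) (by fun_prop) hr
    have hRm' : Measurable (fun ω i => R i ω) := measurable_pi_iff.2 hRm
    have := hi.integral_fun_mul_eq_mul_integral
      (hg.comp hWm).aestronglyMeasurable (hr.comp hRm').aestronglyMeasurable
    simp only [Function.comp_apply] at this
    rw [this, ← hWlaw, integral_map hWm.aemeasurable hg.aestronglyMeasurable]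
  have fb : ∀ {g : Ω → ℝ}, Integrable g μ → Integrable (fun ω => f (W ω) * g ω) μ := by
    intro g hg
    refine hg.bdd_mul (c := 1) (hfm.comp hWm).aestronglyMeasurable (ae_of_all _ fun ω => ?_)
    rw [Real.norm_eq_abs, abs_le]
    exact hfb _
  have hmom : ∀ k, ∫ ω, f (W ω) * W ω ^ k ∂μ = gaussMoment f k := by
    intro k
    rw [gaussMoment, ← hWlaw, integral_map hWm.aemeasurable (by fun_prop)]
  refine ⟨by simpa using hmom 0, ?_, ?_⟩
  · intro i
    have : ∀ ω, f (W ω) * X ω i = f (W ω) * R i ω + β i * (f (W ω) * W ω) := by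
      intro ω; simp only [hR]; ring
    have h0 := key f (fun r => r i) hfm (by fun_prop)
    have hm1 := hmom 1
    simp only [pow_one] at hm1
    simp only [hR1, mul_zero] at h0
    change ∫ ω, f (W ω) * X ω i ∂μ = _
    simp_rw [this]
    rw [integral_add (fb (hRI i)) ((fb hWI).const_mul _), integral_const_mul, h0, hm1]; ring
  · intro i j
    have hRWI : ∀ j, Integrable (fun ω => R j ω * W ω) μ := fun j => (hRL j).integrable_mul hWL
    have : ∀ ω, f (W ω) * (X ω i * X ω j) = f (W ω) * (R i ω * R j ω)
        + β j * (f (W ω) * (R i ω * W ω)) + β i * (f (W ω) * (R j ω * W ω))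
        + (β i * β j) * (f (W ω) * (W ω * W ω)) := by
      intro ω; simp only [hR]; ring
    have h0 := key f (fun r => r i * r j) hfm (by fun_prop)
    have h01 : ∀ j, ∫ ω, f (W ω) * (R j ω * W ω) ∂μ = 0 := by
      intro j
      have := key (fun z => f z * z) (fun r => r j) (by fun_prop) (by fun_prop)
      simp only [hR1, mul_zero] at this
      rw [← this]
      congr 1; ext ω; ring
    have hm2 := hmom 2
    have hm0 : ∫ z, f z ∂(gaussianReal 0 1) = gaussMoment f 0 := by simp [gaussMoment]
    simp only [hRR, hm0] at h0
    simp only [pow_two] at hm2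
    change ∫ ω, f (W ω) * (X ω i * X ω j) ∂μ = _
    simp_rw [this]
    rw [integral_add, integral_add, integral_add, integral_const_mul, integral_const_mul,
      integral_const_mul, h0, h01, h01, hm2]
    · ring
    · exact fb (hRRI i j)
    · exact (fb (hRWI i)).const_mul _
    · exact (fb (hRRI i j)).add ((fb (hRWI i)).const_mul _)
    · exact (fb (hRWI j)).const_mul _
    · exact ((fb (hRRI i j)).add ((fb (hRWI i)).const_mul _)).add ((fb (hRWI j)).const_mul _)
    · exact (fb hWWI).const_mul _

lemma model_cond {Ω : Type*} [mΩ : MeasurableSpace Ω] (μ : Measure Ω) [IsProbabilityMeasure μ]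
    (p : ℕ) (q : (Fin p → ℝ) → ℝ) (hq : Measurable q) (hqb : ∀ z, q z ∈ Set.Icc (-1 : ℝ) 1)
    (X : Ω → Fin p → ℝ) (Y : Ω → ℝ) (hXm : Measurable X) (hYm : Measurable Y)
    (hYval : ∀ ω, Y ω = 1 ∨ Y ω = -1)
    (hmodel : ∀ A : Set (Fin p → ℝ), MeasurableSet A →
      (μ ({ω | Y ω = 1} ∩ X ⁻¹' A)).toReal
        = ∫ ω in X ⁻¹' A, (q (X ω) / 2 + 1 / 2) ∂μ)
    (h : (Fin p → ℝ) → ℝ) (hh : Measurable h) (hi : Integrable (fun ω => h (X ω)) μ) :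
    ∫ ω, Y ω * h (X ω) ∂μ = ∫ ω, q (X ω) * h (X ω) ∂μ := by
  have hle : MeasurableSpace.comap X inferInstance ≤ mΩ := hXm.comap_le
  have hYb : ∀ ω, ‖Y ω‖ ≤ 1 := fun ω => by rcases hYval ω with h | h <;> simp [h]
  have hYI : Integrable Y μ := Integrable.of_bound hYm.aestronglyMeasurable 1 (ae_of_all _ hYb)
  have hqI : Integrable (fun ω => q (X ω)) μ :=
    Integrable.of_bound (hq.comp hXm).aestronglyMeasurable 1 (ae_of_all _ fun ω => by
      rw [Real.norm_eq_abs, abs_le]; exact hqb _)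
  have hX' : Measurable[MeasurableSpace.comap X inferInstance] X := comap_measurable X
  have hce : (fun ω => q (X ω)) =ᵐ[μ] μ[Y | MeasurableSpace.comap X inferInstance] := by
    refine ae_eq_condExp_of_forall_setIntegral_eq hle hYI (fun _ _ _ => hqI.integrableOn) ?_
      (hq.comp hX').stronglyMeasurable.aestronglyMeasurable
    rintro _ ⟨A, hA, rfl⟩ _
    have h1 := hmodel A hA
    have hS : MeasurableSet {ω | Y ω = 1} := hYm (measurableSet_singleton 1)
    have hY2 : ∀ ω, Y ω = 2 * ({ω | Y ω = 1}.indicator (fun _ => (1 : ℝ)) ω) - 1 := by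
      intro ω
      rcases hYval ω with h | h
      · rw [Set.indicator_of_mem (by exact h), h]; norm_num
      · rw [Set.indicator_of_notMem (by simp only [Set.mem_ofPred_eq, h]; norm_num), h]; norm_num
    have h2 : ∫ ω in X ⁻¹' A, {ω | Y ω = 1}.indicator (fun _ => (1 : ℝ)) ω ∂μ
        = (μ ({ω | Y ω = 1} ∩ X ⁻¹' A)).toReal := by
      rw [integral_indicator hS, Measure.restrict_restrict hS]
      simp [Measure.real]
    have h3 : ∫ ω in X ⁻¹' A, Y ω ∂μ = 2 * (μ ({ω | Y ω = 1} ∩ X ⁻¹' A)).toReal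
        - μ.real (X ⁻¹' A) := by
      rw [← h2, ← integral_const_mul]
      have hc : ∫ ω in X ⁻¹' A, (1 : ℝ) ∂μ = μ.real (X ⁻¹' A) := by simp
      rw [← hc, ← integral_sub]
      · exact integral_congr_ae (ae_of_all _ hY2)
      · exact (((integrable_const (1 : ℝ)).indicator hS).const_mul 2)
      · exact integrable_const _
    have h4 : ∫ ω in X ⁻¹' A, (q (X ω) / 2 + 1 / 2) ∂μ
        = (∫ ω in X ⁻¹' A, q (X ω) ∂μ) / 2 + μ.real (X ⁻¹' A) * (1 / 2) := by
      rw [integral_add (hqI.integrableOn.div_const 2) (integrable_const _), integral_div]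
      simp
    rw [h3, h1, h4]; ring
  have hYh : Integrable (Y * fun ω => h (X ω)) μ :=
    hi.bdd_mul (c := 1) hYm.aestronglyMeasurable (ae_of_all _ hYb)
  have hpull := condExp_mul_of_stronglyMeasurable_right (μ := μ)
    (hh.comp hX').stronglyMeasurable hYh hYI
  have := integral_condExp (μ := μ) (f := Y * fun ω => h (X ω)) hle
  change ∫ ω, (Y * fun ω => h (X ω)) ω ∂μ = _
  rw [← this]
  refine integral_congr_ae ?_
  filter_upwards [hpull, hce] with ω h1 h2
  refine Eq.trans h1 ?_
  simp [← h2]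

/-- If `(Y,X)` and `(Y',X')` are independent copies of the pair from the model
`P(Y = 1 | X = x) = f(⟨x,β*⟩)/2 + 1/2` with `X ~ N(0, I_p)` and `β* ∈ S^{p−1}`, then
`E[(Y−Y')²(X−X')(X−X')ᵀ] = 4φ(f)·β*β*ᵀ + 4(1−μ₀²)·I_p`. In particular, if `φ(f) > 0`
then `β*` is the leading eigenvector of this matrix, with eigengap `4φ(f)`. -/
theorem second_moment_diff_matrix
    {Ω : Type*} [MeasurableSpace Ω] (μ : Measure Ω) [IsProbabilityMeasure μ]
    (p : ℕ) (β : Fin p → ℝ) (hβ : ∑ i, β i ^ 2 = 1)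
    (f : ℝ → ℝ) (hfm : Measurable f) (hfb : ∀ z, f z ∈ Set.Icc (-1 : ℝ) 1)
    (X X' : Ω → Fin p → ℝ) (Y Y' : Ω → ℝ)
    (hXm : Measurable X) (hX'm : Measurable X') (hYm : Measurable Y) (hY'm : Measurable Y')
    (hYval : ∀ ω, Y ω = 1 ∨ Y ω = -1)
    (hXlaw : Measure.map X μ = Measure.pi fun _ : Fin p => gaussianReal 0 1)
    (hmodel : ∀ A : Set (Fin p → ℝ), MeasurableSet A →
      (μ ({ω | Y ω = 1} ∩ X ⁻¹' A)).toReal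
        = ∫ ω in X ⁻¹' A, (f (∑ i, X ω i * β i) / 2 + 1 / 2) ∂μ)
    (hident : Measure.map (fun ω => (Y ω, X ω)) μ = Measure.map (fun ω => (Y' ω, X' ω)) μ)
    (hindep : IndepFun (fun ω => (Y ω, X ω)) (fun ω => (Y' ω, X' ω)) μ)
    (M : Matrix (Fin p) (Fin p) ℝ)
    (hM : ∀ i j, M i j
      = ∫ ω, (Y ω - Y' ω) ^ 2 * ((X ω i - X' ω i) * (X ω j - X' ω j)) ∂μ) :
    (M = Matrix.of fun i j =>
        4 * phiFun f * (β i * β j)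
          + 4 * (1 - gaussMoment f 0 ^ 2) * (if i = j then 1 else 0)) ∧
    (0 < phiFun f →
      M.mulVec β = (4 * phiFun f + 4 * (1 - gaussMoment f 0 ^ 2)) • β ∧
      ∀ v : Fin p → ℝ, (∑ i, v i * β i) = 0 →
        M.mulVec v = (4 * (1 - gaussMoment f 0 ^ 2)) • v) := by
  obtain ⟨hG, h1, h2⟩ := basic_gauss μ p X hXm hXlaw
  obtain ⟨g0, g1, g2⟩ := gauss_moments μ p β hβ f hfm hfb X hXm hXlaw
  have hm : ∀ i, Measurable fun ω => X ω i := fun i => measurable_pi_iff.1 hXm i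
  have hL : ∀ i, MemLp (fun ω => X ω i) 2 μ := fun i =>
    (HasGaussianLaw.eval (X := fun i ω => X ω i) hG i).memLp_two
  have hI : ∀ i, Integrable (fun ω => X ω i) μ := fun i => (hL i).integrable (by norm_num)
  have hII : ∀ i j, Integrable (fun ω => X ω i * X ω j) μ := fun i j => (hL i).integrable_mul (hL j)
  have hYb : ∀ ω, ‖Y ω‖ ≤ 1 := fun ω => by rcases hYval ω with h | h <;> simp [h]
  have hc := model_cond μ p (fun x => f (∑ i, x i * β i)) (by fun_prop) (fun _ => hfb _) X Y hXm hYm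
    hYval hmodel
  have y0 : ∫ ω, Y ω ∂μ = gaussMoment f 0 := by
    have := hc (fun _ => 1) (by fun_prop) (integrable_const _)
    simpa [g0] using this
  have y1 : ∀ i, ∫ ω, Y ω * X ω i ∂μ = gaussMoment f 1 * β i := fun i => by
    rw [← g1]; exact hc (fun x => x i) (by fun_prop) (hI i)
  have y2 : ∀ i j, ∫ ω, Y ω * (X ω i * X ω j) ∂μ = gaussMoment f 0 * (if i = j then 1 else 0)
        + (gaussMoment f 2 - gaussMoment f 0) * (β i * β j) := fun i j => by
    rw [← g2]; exact hc (fun x => x i * x j) (by fun_prop) (hII i j)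
  have yI : ∀ {g : Ω → ℝ}, Integrable g μ → Integrable (fun ω => Y ω * g ω) μ := fun hg =>
    hg.bdd_mul (c := 1) hYm.aestronglyMeasurable (ae_of_all _ hYb)
  have hYI : Integrable Y μ := by simpa using yI (integrable_const (1 : ℝ))
  have hP : Measurable fun ω => (Y ω, X ω) := hYm.prodMk hXm
  have hP' : Measurable fun ω => (Y' ω, X' ω) := hY'm.prodMk hX'm
  have hYsq : ∀ᵐ ω ∂μ, Y' ω ^ 2 = 1 := by
    have h0 : ∀ᵐ z ∂(Measure.map (fun ω => (Y ω, X ω)) μ), z.1 ^ 2 = 1 := by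
      rw [ae_map_iff hP.aemeasurable (measurableSet_eq_fun (by fun_prop) (by fun_prop))]
      exact ae_of_all _ fun ω => by rcases hYval ω with h | h <;> simp [h]
    rw [hident] at h0
    exact ae_of_ae_map hP'.aemeasurable h0
  have key : ∀ F G : ℝ × (Fin p → ℝ) → ℝ, Measurable F → Measurable G →
      Integrable (fun ω => F (Y ω, X ω)) μ → Integrable (fun ω => G (Y ω, X ω)) μ →
      Integrable (fun ω => F (Y ω, X ω) * G (Y' ω, X' ω)) μ ∧
      ∫ ω, F (Y ω, X ω) * G (Y' ω, X' ω) ∂μ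
        = (∫ ω, F (Y ω, X ω) ∂μ) * ∫ ω, G (Y ω, X ω) ∂μ := by
    intro F G hF hGm iF iG
    have iG' : Integrable (fun ω => G (Y' ω, X' ω)) μ := by
      have := (integrable_map_measure hGm.aestronglyMeasurable hP.aemeasurable).2 iG
      rw [hident] at this
      exact (integrable_map_measure hGm.aestronglyMeasurable hP'.aemeasurable).1 this
    have hi := hindep.comp hF hGm
    refine ⟨hi.integrable_mul iF iG', ?_⟩
    have e := hi.integral_fun_mul_eq_mul_integral iF.aestronglyMeasurable iG'.aestronglyMeasurable
    simp only [Function.comp_apply] at e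
    rw [e]
    congr 1
    rw [← integral_map hP'.aemeasurable hGm.aestronglyMeasurable, ← hident,
      integral_map hP.aemeasurable hGm.aestronglyMeasurable]
  have hMeq : M = Matrix.of fun i j =>
        4 * phiFun f * (β i * β j)
          + 4 * (1 - gaussMoment f 0 ^ 2) * (if i = j then 1 else 0) := by
    ext i j
    rw [hM, Matrix.of_apply]
    obtain ⟨a1, b1⟩ := key (fun z => z.2 i * z.2 j) (fun _ => 1) (by fun_prop) (by fun_prop)
      (hII i j) (integrable_const _)
    obtain ⟨a2, b2⟩ := key (fun z => z.2 i) (fun z => z.2 j) (by fun_prop) (by fun_prop)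
      (hI i) (hI j)
    obtain ⟨a3, b3⟩ := key (fun z => z.2 j) (fun z => z.2 i) (by fun_prop) (by fun_prop)
      (hI j) (hI i)
    obtain ⟨a4, b4⟩ := key (fun _ => 1) (fun z => z.2 i * z.2 j) (by fun_prop) (by fun_prop)
      (integrable_const _) (hII i j)
    obtain ⟨a5, b5⟩ := key (fun z => z.1 * (z.2 i * z.2 j)) (fun z => z.1) (by fun_prop)
      (by fun_prop) (yI (hII i j)) hYI
    obtain ⟨a6, b6⟩ := key (fun z => z.1 * z.2 i) (fun z => z.1 * z.2 j) (by fun_prop)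
      (by fun_prop) (yI (hI i)) (yI (hI j))
    obtain ⟨a7, b7⟩ := key (fun z => z.1 * z.2 j) (fun z => z.1 * z.2 i) (by fun_prop)
      (by fun_prop) (yI (hI j)) (yI (hI i))
    obtain ⟨a8, b8⟩ := key (fun z => z.1) (fun z => z.1 * (z.2 i * z.2 j)) (by fun_prop)
      (by fun_prop) hYI (yI (hII i j))
    simp only [h1, h2, y0, y1, y2, integral_const, probReal_univ, one_smul]
      at b1 b2 b3 b4 b5 b6 b7 b8
    dsimp only at a1 a2 a3 a4 a5 a6 a7 a8
    have ex : ∫ ω, (Y ω - Y' ω) ^ 2 * ((X ω i - X' ω i) * (X ω j - X' ω j)) ∂μ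
        = ∫ ω, 2 * (X ω i * X ω j * 1 - X ω i * X' ω j - X ω j * X' ω i + 1 * (X' ω i * X' ω j)
          - Y ω * (X ω i * X ω j) * Y' ω + Y ω * X ω i * (Y' ω * X' ω j)
          + Y ω * X ω j * (Y' ω * X' ω i) - Y ω * (Y' ω * (X' ω i * X' ω j))) ∂μ := by
      refine integral_congr_ae ?_
      filter_upwards [hYsq] with ω h'
      have h : Y ω ^ 2 = 1 := by rcases hYval ω with h | h <;> simp [h]
      linear_combination ((X ω i - X' ω i) * (X ω j - X' ω j)) * (h + h')
    rw [ex, integral_const_mul,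
      integral_sub ((((((a1.sub' a2).sub' a3).fun_add a4).sub' a5).fun_add a6).fun_add a7) a8,
      integral_add (((((a1.sub' a2).sub' a3).fun_add a4).sub' a5).fun_add a6) a7,
      integral_add ((((a1.sub' a2).sub' a3).fun_add a4).sub' a5) a6,
      integral_sub (((a1.sub' a2).sub' a3).fun_add a4) a5,
      integral_add ((a1.sub' a2).sub' a3) a4,
      integral_sub (a1.sub' a2) a3,
      integral_sub a1 a2, b1, b2, b3, b4, b5, b6, b7, b8, phiFun]
    ring
  have hmv : ∀ v : Fin p → ℝ, M.mulVec v = (4 * phiFun f * ∑ i, v i * β i) • β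
      + (4 * (1 - gaussMoment f 0 ^ 2)) • v := by
    intro v
    ext i
    rw [hMeq]
    simp only [Matrix.mulVec, dotProduct, Matrix.of_apply, add_mul, Finset.sum_add_distrib,
      Pi.add_apply, Pi.smul_apply, smul_eq_mul]
    congr 1
    · rw [Finset.mul_sum, Finset.sum_mul]
      exact Finset.sum_congr rfl fun j _ => by ring
    · simp
  refine ⟨hMeq, fun _ => ⟨?_, fun v hv => ?_⟩⟩
  · rw [hmv, add_smul]
    have : ∑ i, β i * β i = 1 := by rw [← hβ]; exact Finset.sum_congr rfl fun j _ => by ring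
    rw [this, mul_one]
  · rw [hmv, hv]; simp
end

section
/- Let Z and Z' be independent standard Gaussian vectors in ℝ^p (distribution N(0, I_p)), let Z₁ and Z₁' denote their first coordinates, and let f : ℝ → [−1,1] be measurable. Then E[(2 − 2 f(Z₁) f(Z₁'))·(Z − Z')(Z − Z')ᵀ] = 4(μ₁² − μ₀μ₂ + μ₀²)·e₁e₁ᵀ + 4(1 − μ₀²)·I_p, where e₁ = (1,0,…,0)ᵀ. -/
open MeasureTheory ProbabilityTheory

lemma gp_indep {p : ℕ} (a b k : Fin p) (hak : a ≠ k) (hbk : b ≠ k)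
    (G : ℝ × ℝ → ℝ) (hG : Measurable G) (h : ℝ → ℝ) (hh : Measurable h) :
    ∫ x : Fin p → ℝ, G (x a, x b) * h (x k) ∂(Measure.pi fun _ : Fin p => gaussianReal 0 1)
      = (∫ x : Fin p → ℝ, G (x a, x b) ∂(Measure.pi fun _ : Fin p => gaussianReal 0 1))
        * ∫ x : Fin p → ℝ, h (x k) ∂(Measure.pi fun _ : Fin p => gaussianReal 0 1) := by
  have h1 : iIndepFun (fun (i : Fin p) (x : Fin p → ℝ) => x i)
      (Measure.pi fun _ : Fin p => gaussianReal 0 1) :=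
    iIndepFun_pi (X := fun _ => id) (fun _ => aemeasurable_id)
  have h2 := (h1.indepFun_prodMk (fun i => measurable_pi_apply i) a b k hak hbk).comp hG hh
  exact h2.integral_fun_mul_eq_mul_integral
    (Measurable.aestronglyMeasurable (by fun_prop))
    (Measurable.aestronglyMeasurable (by fun_prop))

lemma gp_marg {p : ℕ} (k : Fin p) (h : ℝ → ℝ) (hh : Measurable h) :
    ∫ x : Fin p → ℝ, h (x k) ∂(Measure.pi fun _ : Fin p => gaussianReal 0 1)
      = ∫ z, h z ∂(gaussianReal 0 1) := by
  have := (measurePreserving_eval (fun _ : Fin p => gaussianReal 0 1) k).map_eq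
  conv_rhs => rw [← this]
  rw [integral_map (measurable_pi_apply k).aemeasurable hh.aestronglyMeasurable]

lemma gp_sq : ∫ z, z ^ 2 ∂(gaussianReal 0 1) = (1 : ℝ) := by
  have h := variance_eq_sub (memLp_id_gaussianReal (μ := 0) (v := 1) 2)
  rw [variance_id_gaussianReal] at h
  simpa [integral_id_gaussianReal] using h.symm

lemma gp_first {p : ℕ} (o i : Fin p) (f : ℝ → ℝ) (hf : Measurable f) :
    ∫ x : Fin p → ℝ, f (x o) * x i ∂(Measure.pi fun _ : Fin p => gaussianReal 0 1)
      = if i = o then gaussMoment f 1 else 0 := by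
  split_ifs with h
  · subst h
    simpa [gaussMoment] using gp_marg i (fun z => f z * z) (by fun_prop)
  · have := gp_indep o o i (Ne.symm h) (Ne.symm h) (fun q => f q.1) (by fun_prop)
      (fun z => z) (by fun_prop)
    simp only at this
    rw [this, gp_marg i (fun z => z) (by fun_prop), integral_id_gaussianReal, mul_zero]

lemma gp_zero {p : ℕ} (o : Fin p) (f : ℝ → ℝ) (hf : Measurable f) :
    ∫ x : Fin p → ℝ, f (x o) ∂(Measure.pi fun _ : Fin p => gaussianReal 0 1)
      = gaussMoment f 0 := by
  simpa [gaussMoment] using gp_marg o f hf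

lemma gp_second {p : ℕ} (o i j : Fin p) (f : ℝ → ℝ) (hf : Measurable f) :
    ∫ x : Fin p → ℝ, f (x o) * (x i * x j) ∂(Measure.pi fun _ : Fin p => gaussianReal 0 1)
      = if i = j then (if i = o then gaussMoment f 2 else gaussMoment f 0) else 0 := by
  have key : ∀ a b : Fin p, a ≠ b → b ≠ o →
      ∫ x : Fin p → ℝ, f (x o) * (x a * x b) ∂(Measure.pi fun _ : Fin p => gaussianReal 0 1)
      = 0 := by
    intro a b hab hbo
    have := gp_indep o a b hbo.symm hab (fun q => f q.1 * q.2) (by fun_prop)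
      (fun z => z) (by fun_prop)
    simp only [mul_assoc] at this
    rw [this, gp_marg b (fun z => z) (by fun_prop), integral_id_gaussianReal, mul_zero]
  split_ifs with h h'
  · subst h; subst h'
    simpa [gaussMoment, pow_two] using gp_marg i (fun z => f z * (z * z)) (by fun_prop)
  · subst h
    have := gp_indep o o i (Ne.symm h') (Ne.symm h') (fun q => f q.1) (by fun_prop)
      (fun z => z ^ 2) (by fun_prop)
    simp only [pow_two] at this
    rw [this, gp_zero o f hf, gp_marg i (fun z => z * z) (by fun_prop)]
    have h2 := gp_sq
    simp only [pow_two] at h2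
    rw [h2, mul_one]
  · by_cases hj : j = o
    · have hi : i ≠ o := fun e => h (e.trans hj.symm)
      refine (integral_congr_ae (Filter.Eventually.of_forall fun x => ?_)).trans
        (key j i (Ne.symm h) hi)
      show f (x o) * (x i * x j) = f (x o) * (x j * x i)
      ring
    · exact key i j h hj

lemma gp_memLp {p : ℕ} (i : Fin p) :
    MemLp (fun x : Fin p → ℝ => x i) 2 (Measure.pi fun _ : Fin p => gaussianReal 0 1) :=
  (memLp_id_gaussianReal (μ := 0) (v := 1) 2).comp_measurePreserving
    (measurePreserving_eval (fun _ : Fin p => gaussianReal 0 1) i)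

lemma gp_bdd {p : ℕ} (o : Fin p) (f : ℝ → ℝ) (hf : Measurable f)
    (hfb : ∀ z, f z ∈ Set.Icc (-1 : ℝ) 1) (G : (Fin p → ℝ) → ℝ)
    (hG : Integrable G (Measure.pi fun _ : Fin p => gaussianReal 0 1)) :
    Integrable (fun x => f (x o) * G x) (Measure.pi fun _ : Fin p => gaussianReal 0 1) := by
  refine hG.bdd_mul (c := 1) (Measurable.aestronglyMeasurable (by fun_prop)) ?_
  exact Filter.Eventually.of_forall fun x => abs_le.2 (hfb (x o))

/-- For `Z, Z'` independent standard Gaussian vectors in `ℝ^p` with first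
coordinates `Z₁, Z₁'`, and `f : ℝ → [−1,1]` measurable,
`E[(2 − 2 f(Z₁) f(Z₁'))·(Z − Z')(Z − Z')ᵀ] = 4(μ₁² − μ₀μ₂ + μ₀²)·e₁e₁ᵀ + 4(1 − μ₀²)·I_p`. -/
theorem gaussian_pair_second_moment (p : ℕ) (hp : 0 < p)
    (f : ℝ → ℝ) (hfm : Measurable f) (hfb : ∀ z, f z ∈ Set.Icc (-1 : ℝ) 1)
    (ν : Measure (Fin p → ℝ)) (hν : ν = Measure.pi fun _ : Fin p => gaussianReal 0 1) :
    ∀ i j : Fin p,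
      (∫ q : (Fin p → ℝ) × (Fin p → ℝ),
          (2 - 2 * f (q.1 ⟨0, hp⟩) * f (q.2 ⟨0, hp⟩))
            * ((q.1 i - q.2 i) * (q.1 j - q.2 j)) ∂(ν.prod ν))
        = 4 * phiFun f * ((if i = (⟨0, hp⟩ : Fin p) then 1 else 0)
              * (if j = (⟨0, hp⟩ : Fin p) then 1 else 0))
          + 4 * (1 - gaussMoment f 0 ^ 2) * (if i = j then 1 else 0) := by
  intro i j
  subst hν
  set o : Fin p := ⟨0, hp⟩ with ho
  set ν := Measure.pi fun _ : Fin p => gaussianReal 0 1 with hν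
  have c1 : Integrable (fun _ : Fin p → ℝ => (1 : ℝ)) ν := integrable_const _
  have ci : Integrable (fun x : Fin p → ℝ => x i) ν := (gp_memLp i).integrable one_le_two
  have cj : Integrable (fun x : Fin p → ℝ => x j) ν := (gp_memLp j).integrable one_le_two
  have cij : Integrable (fun x : Fin p → ℝ => x i * x j) ν :=
    (gp_memLp i).integrable_mul (gp_memLp j)
  have d1 : Integrable (fun x : Fin p → ℝ => f (x o)) ν := by
    simpa using gp_bdd o f hfm hfb _ c1
  have di : Integrable (fun x : Fin p → ℝ => f (x o) * x i) ν := gp_bdd o f hfm hfb _ ci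
  have dj : Integrable (fun x : Fin p → ℝ => f (x o) * x j) ν := gp_bdd o f hfm hfb _ cj
  have dij : Integrable (fun x : Fin p → ℝ => f (x o) * (x i * x j)) ν := gp_bdd o f hfm hfb _ cij
  have e1 := (c1.mul_prod cij).const_mul 2
  have e2 := (cij.mul_prod c1).const_mul 2
  have e3 := (ci.mul_prod cj).const_mul 2
  have e4 := (cj.mul_prod ci).const_mul 2
  have e5 := (d1.mul_prod dij).const_mul 2
  have e6 := (dij.mul_prod d1).const_mul 2
  have e7 := (di.mul_prod dj).const_mul 2
  have e8 := (dj.mul_prod di).const_mul 2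
  have expand : (fun q : (Fin p → ℝ) × (Fin p → ℝ) => (2 - 2 * f (q.1 o) * f (q.2 o))
      * ((q.1 i - q.2 i) * (q.1 j - q.2 j))) = fun q =>
      (((((((2 * ((1 : ℝ) * (q.2 i * q.2 j)) + 2 * ((q.1 i * q.1 j) * (1 : ℝ)))
        - 2 * (q.1 i * q.2 j)) - 2 * (q.1 j * q.2 i))
        - 2 * (f (q.1 o) * (f (q.2 o) * (q.2 i * q.2 j))))
        - 2 * ((f (q.1 o) * (q.1 i * q.1 j)) * f (q.2 o)))
        + 2 * ((f (q.1 o) * q.1 i) * (f (q.2 o) * q.2 j)))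
        + 2 * ((f (q.1 o) * q.1 j) * (f (q.2 o) * q.2 i))) := by
    funext q; ring
  rw [expand,
    integral_add ((((((e1.fun_add e2).sub' e3).sub' e4).sub' e5).sub' e6).fun_add e7) e8,
    integral_add (((((e1.fun_add e2).sub' e3).sub' e4).sub' e5).sub' e6) e7,
    integral_sub ((((e1.fun_add e2).sub' e3).sub' e4).sub' e5) e6,
    integral_sub (((e1.fun_add e2).sub' e3).sub' e4) e5,
    integral_sub ((e1.fun_add e2).sub' e3) e4,
    integral_sub (e1.fun_add e2) e3, integral_add e1 e2]
  simp only [integral_const_mul (2 : ℝ)]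
  rw [integral_prod_mul (μ := ν) (ν := ν) (fun _ => (1 : ℝ)) (fun y => y i * y j),
    integral_prod_mul (μ := ν) (ν := ν) (fun y => y i * y j) (fun _ => (1 : ℝ)),
    integral_prod_mul (μ := ν) (ν := ν) (fun y => y i) (fun y => y j),
    integral_prod_mul (μ := ν) (ν := ν) (fun y => y j) (fun y => y i),
    integral_prod_mul (μ := ν) (ν := ν) (fun y => f (y o)) (fun y => f (y o) * (y i * y j)),
    integral_prod_mul (μ := ν) (ν := ν) (fun y => f (y o) * (y i * y j)) (fun y => f (y o)),
    integral_prod_mul (μ := ν) (ν := ν) (fun y => f (y o) * y i) (fun y => f (y o) * y j),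
    integral_prod_mul (μ := ν) (ν := ν) (fun y => f (y o) * y j) (fun y => f (y o) * y i)]
  have m0 : ∀ k : Fin p, ∫ x, x k ∂ν = 0 := fun k => by
    rw [hν, gp_marg k (fun z => z) (by fun_prop), integral_id_gaussianReal]
  have mm : ∫ x, x i * x j ∂ν = if i = j then 1 else 0 := by
    have := gp_second o i j (fun _ => (1 : ℝ)) (by fun_prop)
    simpa [gaussMoment, gp_sq] using this
  rw [mm, m0, m0, gp_second o i j f hfm, gp_first o i f hfm, gp_first o j f hfm,
    gp_zero o f hfm]
  simp only [integral_const, probReal_univ, smul_eq_mul, phiFun]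
  by_cases hij : i = j
  · subst hij
    by_cases hi : i = o
    · simp only [hi, if_true]; ring
    · simp only [hi, if_true, if_false]; ring
  · by_cases hi : i = o
    · have hj : j ≠ o := fun e => hij (hi.trans e.symm)
      simp only [hij, hj, if_false]; ring
    · simp only [hij, hi, if_false]; ring
end

section
/- Fix m ∈ (0,1), L > 0 and f ∈ F(m,L). For β ∈ S^{p−1}, let P_β denote the joint distribution of (Y, X) where X ~ N(0, I_p) and P(Y = 1 | X = x) = f(⟨x, β⟩)/2 + 1/2. Then for all β, β' ∈ S^{p−1}, the Kullback–Leibler divergence satisfies D_KL(P_{β'} ‖ P_β) ≤ L²·‖β − β'‖₂² / (m(1−m)). -/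
open MeasureTheory ProbabilityTheory

/-- The joint law of `(Y, X)` in the model: `X ~ N(0, I_p)` and, given `X = x`,
`Y = 1` with probability `f(⟨x,β⟩)/2 + 1/2` and `Y = −1` otherwise. -/
noncomputable def modelLaw (p : ℕ) (f : ℝ → ℝ) (β : Fin p → ℝ) :
    Measure (ℝ × (Fin p → ℝ)) :=
  (Measure.pi fun _ : Fin p => gaussianReal 0 1).bind fun x =>
    ENNReal.ofReal ((1 + f (∑ i, x i * β i)) / 2) • Measure.dirac ((1 : ℝ), x)
      + ENNReal.ofReal ((1 - f (∑ i, x i * β i)) / 2) • Measure.dirac ((-1 : ℝ), x)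

/-- The Kullback–Leibler divergence `D_KL(P‖Q) = ∫ log (dP/dQ) dP`. -/
noncomputable def klDivergence {α : Type*} [MeasurableSpace α] (P Q : Measure α) : ℝ :=
  ∫ a, Real.log ((P.rnDeriv Q a).toReal) ∂P

lemma aux_inner_measurable (p : ℕ) (β : Fin p → ℝ) :
    Measurable (fun x : Fin p → ℝ => ∑ i, x i * β i) := by fun_prop

lemma aux_kernel_measurable (p : ℕ) (f : ℝ → ℝ) (hfm : Measurable f) (β : Fin p → ℝ) :
    Measurable (fun x : Fin p → ℝ =>
    ENNReal.ofReal ((1 + f (∑ i, x i * β i)) / 2) • Measure.dirac ((1 : ℝ), x)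
      + ENNReal.ofReal ((1 - f (∑ i, x i * β i)) / 2) • Measure.dirac ((-1 : ℝ), x)) := by
  have h0 : Measurable (fun x : Fin p → ℝ => f (∑ i, x i * β i)) :=
    hfm.comp (aux_inner_measurable p β)
  refine Measure.measurable_of_measurable_coe _ fun s hs => ?_
  simp only [Measure.add_apply, Measure.smul_apply, Measure.dirac_apply' _ hs, smul_eq_mul]
  have h1 : Measurable fun x : Fin p → ℝ => s.indicator (1 : ℝ × (Fin p → ℝ) → ENNReal) (1, x) :=
    (measurable_one.indicator hs).comp (by fun_prop)
  have h2 : Measurable fun x : Fin p → ℝ => s.indicator (1 : ℝ × (Fin p → ℝ) → ENNReal) (-1, x) :=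
    (measurable_one.indicator hs).comp (by fun_prop)
  fun_prop

lemma aux_lintegral (p : ℕ) (f : ℝ → ℝ) (hfm : Measurable f) (β : Fin p → ℝ)
    (F : ℝ × (Fin p → ℝ) → ENNReal) (hF : Measurable F) :
    ∫⁻ z, F z ∂(modelLaw p f β) = ∫⁻ x,
      (ENNReal.ofReal ((1 + f (∑ i, x i * β i)) / 2) * F (1, x)
      + ENNReal.ofReal ((1 - f (∑ i, x i * β i)) / 2) * F (-1, x))
      ∂(Measure.pi fun _ : Fin p => gaussianReal 0 1) := by
  rw [modelLaw, Measure.lintegral_bind (aux_kernel_measurable p f hfm β).aemeasurable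
    hF.aemeasurable]
  congr 1 with x
  rw [lintegral_add_measure, lintegral_smul_measure, lintegral_smul_measure,
    lintegral_dirac' _ hF, lintegral_dirac' _ hF]
  simp

/-- real likelihood ratio -/
noncomputable def auxR (p : ℕ) (f : ℝ → ℝ) (β β' : Fin p → ℝ) (z : ℝ × (Fin p → ℝ)) : ℝ :=
  (1 + z.1 * f (∑ i, z.2 i * β' i)) / (1 + z.1 * f (∑ i, z.2 i * β i))

lemma auxR_measurable (p : ℕ) (f : ℝ → ℝ) (hfm : Measurable f) (β β' : Fin p → ℝ) :
    Measurable (auxR p f β β') := by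
  have h (β : Fin p → ℝ) : Measurable (fun z : ℝ × (Fin p → ℝ) => f (∑ i, z.2 i * β i)) :=
    hfm.comp ((aux_inner_measurable p β).comp measurable_snd)
  have h1 := h β
  have h2 := h β'
  unfold auxR
  fun_prop

lemma aux_withDensity (p : ℕ) (f : ℝ → ℝ) (hfm : Measurable f) (hb : ∀ z, |f z| < 1)
    (β β' : Fin p → ℝ) :
    modelLaw p f β' = (modelLaw p f β).withDensity
      (fun z => ENNReal.ofReal (auxR p f β β' z)) := by
  have hR := (auxR_measurable p f hfm β β').ennreal_ofReal
  ext s hs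
  rw [withDensity_apply _ hs, ← lintegral_indicator hs, ← lintegral_indicator_one hs,
    aux_lintegral _ _ hfm _ _ (measurable_one.indicator hs),
    aux_lintegral _ _ hfm _ _ (hR.indicator hs)]
  congr 1 with x
  have ha := abs_lt.1 (hb (∑ i, x i * β i))
  have key1 : ENNReal.ofReal ((1 + f (∑ i, x i * β i)) / 2) *
      ENNReal.ofReal (auxR p f β β' (1, x)) = ENNReal.ofReal ((1 + f (∑ i, x i * β' i)) / 2) := by
    rw [← ENNReal.ofReal_mul (by linarith)]
    congr 1
    simp only [auxR, one_mul]
    have : 1 + f (∑ i, x i * β i) ≠ 0 := by linarith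
    field_simp
  have key2 : ENNReal.ofReal ((1 - f (∑ i, x i * β i)) / 2) *
      ENNReal.ofReal (auxR p f β β' (-1, x)) =
      ENNReal.ofReal ((1 - f (∑ i, x i * β' i)) / 2) := by
    rw [← ENNReal.ofReal_mul (by linarith)]
    congr 1
    simp only [auxR, neg_one_mul, ← sub_eq_add_neg]
    have : 1 - f (∑ i, x i * β i) ≠ 0 := by linarith
    field_simp
  rw [← key1, ← key2]
  by_cases hs1 : ((1 : ℝ), x) ∈ s <;> by_cases hs2 : ((-1 : ℝ), x) ∈ s <;> simp [hs1, hs2]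

lemma aux_second_moment (p : ℕ) (d : Fin p → ℝ) :
    ∫⁻ x, ENNReal.ofReal ((∑ i, x i * d i) ^ 2) ∂(Measure.pi fun _ : Fin p => gaussianReal 0 1)
      = ENNReal.ofReal (∑ i, d i ^ 2) := by
  set μ := Measure.pi fun _ : Fin p => gaussianReal 0 1
  have h1 : ∀ i : Fin p, MemLp (fun y : ℝ => y * d i) 2 (gaussianReal 0 1) := fun i =>
    (memLp_id_gaussianReal' 2 (by simp)).mul_const (d i)
  have h2 : ∀ i : Fin p, MemLp (fun x : Fin p → ℝ => x i * d i) 2 μ := fun i =>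
    (h1 i).comp_measurePreserving (measurePreserving_eval _ i)
  have h3 : MemLp (∑ i, fun x : Fin p → ℝ => x i * d i) 2 μ :=
    memLp_finsetSum' _ fun i _ => h2 i
  have hv := variance_sum_pi h1
  rw [variance_eq_sub h3] at hv
  have hmean : ∫ x, (∑ i, fun x : Fin p → ℝ => x i * d i) x ∂μ = 0 := by
    simp only [Finset.sum_apply]
    rw [integral_finsetSum _ fun i _ => (h2 i).integrable one_le_two]
    refine Finset.sum_eq_zero fun i _ => ?_
    rw [integral_mul_const]
    have : ∫ x : Fin p → ℝ, x i ∂μ = 0 := by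
      rw [integral_eval]
      simp
    rw [this, zero_mul]
  have hvar : ∀ i, Var[fun y : ℝ => y * d i; gaussianReal 0 1] = d i ^ 2 := fun i => by
    rw [variance_mul_const]
    simp
  simp only [hvar, hmean] at hv
  rw [← hv, ← ofReal_integral_eq_lintegral_ofReal]
  · simp [μ]
  · simpa using h3.integrable_sq
  · exact Filter.Eventually.of_forall fun x => sq_nonneg _

lemma aux_pointwise (m L a b t : ℝ) (hm0 : 0 < m) (hm1 : m < 1)
    (ha : |a| ≤ 1 - m) (hb : |b| ≤ 1 - m) (hab : |a - b| ≤ L * |t|) :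
    (1 + a) / 2 * ((1 + a) / (1 + b)) + (1 - a) / 2 * ((1 - a) / (1 - b))
      ≤ 1 + L ^ 2 / (m * (1 - m)) * t ^ 2 := by
  have hb' := abs_le.1 hb
  have h1 : 1 + b ≠ 0 := by linarith
  have h2 : 1 - b ≠ 0 := by linarith
  have h3 : m * (1 - m) ≤ 1 - b ^ 2 := by nlinarith
  have h4 : 0 < m * (1 - m) := mul_pos hm0 (by linarith)
  have h5 : (a - b) ^ 2 ≤ L ^ 2 * t ^ 2 := by
    have := pow_le_pow_left₀ (abs_nonneg _) hab 2
    rwa [sq_abs, mul_pow, sq_abs] at this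
  have e : (1 + a) / 2 * ((1 + a) / (1 + b)) + (1 - a) / 2 * ((1 - a) / (1 - b))
      = 1 + (a - b) ^ 2 / (1 - b ^ 2) := by
    have : 1 - b ^ 2 ≠ 0 := by linarith
    rw [show (1 - b ^ 2) = (1 + b) * (1 - b) by ring] 
    field_simp
    ring
  rw [e, div_mul_eq_mul_div]
  gcongr

lemma aux_lintegral_R (p : ℕ) (m L : ℝ) (hm0 : 0 < m) (hm1 : m < 1)
    (f : ℝ → ℝ) (hfm : Measurable f)
    (hfb : ∀ z, |f z| ≤ 1 - m) (hflip : ∀ z z', |f z - f z'| ≤ L * |z - z'|)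
    (β β' : Fin p → ℝ) :
    ∫⁻ z, ENNReal.ofReal (auxR p f β β' z) ∂(modelLaw p f β') ≤
      ENNReal.ofReal (1 + L ^ 2 * (∑ i, (β i - β' i) ^ 2) / (m * (1 - m))) := by
  rw [aux_lintegral p f hfm β' _ (auxR_measurable p f hfm β β').ennreal_ofReal]
  have h4 : 0 < m * (1 - m) := mul_pos hm0 (by linarith)
  have hC : 0 ≤ L ^ 2 / (m * (1 - m)) := by positivity
  calc _ ≤ ∫⁻ x, (1 + ENNReal.ofReal (L ^ 2 / (m * (1 - m))) *
        ENNReal.ofReal ((∑ i, x i * (β i - β' i)) ^ 2))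
        ∂(Measure.pi fun _ : Fin p => gaussianReal 0 1) := by
        refine lintegral_mono fun x => ?_
        have ha := hfb (∑ i, x i * β' i)
        have hb := hfb (∑ i, x i * β i)
        have ha' := abs_le.1 ha
        have hb' := abs_le.1 hb
        have hab : |f (∑ i, x i * β' i) - f (∑ i, x i * β i)|
            ≤ L * |∑ i, x i * (β i - β' i)| := by
          rw [abs_sub_comm]
          refine (hflip _ _).trans_eq ?_
          simp only [mul_sub, Finset.sum_sub_distrib]
        have := aux_pointwise m L _ _ _ hm0 hm1 ha hb hab
        simp only [auxR, one_mul, neg_one_mul, ← sub_eq_add_neg]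
        rw [← ENNReal.ofReal_mul (by linarith), ← ENNReal.ofReal_mul (by linarith),
          ← ENNReal.ofReal_mul hC, ← ENNReal.ofReal_one,
          ← ENNReal.ofReal_add, ← ENNReal.ofReal_add zero_le_one (by positivity)]
        · exact ENNReal.ofReal_le_ofReal this
        · have : 0 < 1 + f (∑ i, x i * β i) := by linarith
          have : 0 < 1 + f (∑ i, x i * β' i) := by linarith
          positivity
        · have : 0 < 1 - f (∑ i, x i * β i) := by linarith
          have : 0 < 1 - f (∑ i, x i * β' i) := by linarith
          positivity
    _ = _ := by
        rw [lintegral_add_left measurable_const, lintegral_const_mul' _ _ (by simp),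
          aux_second_moment, ← ENNReal.ofReal_mul hC, lintegral_one, measure_univ,
          ← ENNReal.ofReal_one, ← ENNReal.ofReal_add zero_le_one (by positivity)]
        congr 2
        ring

lemma aux_prob (p : ℕ) (f : ℝ → ℝ) (hfm : Measurable f) (hb : ∀ z, |f z| < 1)
    (β : Fin p → ℝ) : IsProbabilityMeasure (modelLaw p f β) := by
  constructor
  rw [← lintegral_one, aux_lintegral p f hfm β _ measurable_const]
  rw [show (1 : ENNReal) = ∫⁻ x, 1 ∂(Measure.pi fun _ : Fin p => gaussianReal 0 1) by simp]
  congr 1 with x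
  have ha := abs_lt.1 (hb (∑ i, x i * β i))
  simp only [lintegral_one, measure_univ, mul_one]
  rw [← ENNReal.ofReal_add (by linarith) (by linarith), ← ENNReal.ofReal_one]
  congr 1
  ring

lemma aux_support (p : ℕ) (f : ℝ → ℝ) (hfm : Measurable f) (hb : ∀ z, |f z| < 1)
    (β β' : Fin p → ℝ) : ∀ᵐ z ∂(modelLaw p f β'), 0 < auxR p f β β' z := by
  have hms : MeasurableSet {z | 0 < auxR p f β β' z} :=
    measurableSet_lt measurable_const (auxR_measurable p f hfm β β')
  have : modelLaw p f β' {z | 0 < auxR p f β β' z}ᶜ = 0 := by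
    rw [← lintegral_indicator_one hms.compl,
      aux_lintegral _ _ hfm _ _ (measurable_one.indicator hms.compl)]
    rw [show (0 : ENNReal) = ∫⁻ x, 0 ∂(Measure.pi fun _ : Fin p => gaussianReal 0 1) by simp]
    congr 1 with x
    have ha := abs_lt.1 (hb (∑ i, x i * β i))
    have ha' := abs_lt.1 (hb (∑ i, x i * β' i))
    have h1 : 0 < auxR p f β β' (1, x) := by
      simp only [auxR, one_mul]
      exact div_pos (by linarith) (by linarith)
    have h2 : 0 < auxR p f β β' (-1, x) := by
      simp only [auxR, neg_one_mul]
      exact div_pos (by linarith) (by linarith)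
    simp [h1, h2]
  exact this

/-- For `f ∈ F(m,L)` and `β, β' ∈ S^{p−1}`, the model laws satisfy
`D_KL(P_{β'} ‖ P_β) ≤ L²·‖β − β'‖₂²/(m(1−m))`. -/
theorem kl_divergence_model_bound (p : ℕ) (m L : ℝ) (hm0 : 0 < m) (hm1 : m < 1)
    (hL : 0 < L) (f : ℝ → ℝ) (hfm : Measurable f)
    (hfb : ∀ z, |f z| ≤ 1 - m) (hflip : ∀ z z', |f z - f z'| ≤ L * |z - z'|)
    (β β' : Fin p → ℝ) (hβ : ∑ i, β i ^ 2 = 1) (hβ' : ∑ i, β' i ^ 2 = 1) :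
    klDivergence (modelLaw p f β') (modelLaw p f β)
      ≤ L ^ 2 * (∑ i, (β i - β' i) ^ 2) / (m * (1 - m)) := by
  have hb : ∀ z, |f z| < 1 := fun z => (hfb z).trans_lt (by linarith)
  have hP := aux_prob p f hfm hb β
  have hP' := aux_prob p f hfm hb β'
  have hRm := auxR_measurable p f hfm β β'
  have hwd := aux_withDensity p f hfm hb β β'
  have hac : modelLaw p f β' ≪ modelLaw p f β := by
    rw [hwd]
    exact withDensity_absolutelyContinuous _ _
  have hpos := aux_support p f hfm hb β β'
  have hrn : (modelLaw p f β').rnDeriv (modelLaw p f β) =ᵐ[modelLaw p f β']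
      fun z => ENNReal.ofReal (auxR p f β β' z) := by
    have := Measure.rnDeriv_withDensity (modelLaw p f β) hRm.ennreal_ofReal
    rw [← hwd] at this
    exact hac.ae_le this
  have hlog : klDivergence (modelLaw p f β') (modelLaw p f β)
      = ∫ z, Real.log (auxR p f β β' z) ∂(modelLaw p f β') := by
    refine integral_congr_ae ?_
    filter_upwards [hrn, hpos] with z h1 h2
    rw [h1, ENNReal.toReal_ofReal h2.le]
  rw [hlog]
  have h4 : 0 < m * (1 - m) := mul_pos hm0 (by linarith)
  have hC : 0 ≤ L ^ 2 * (∑ i, (β i - β' i) ^ 2) / (m * (1 - m)) := by positivity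
  by_cases hint : Integrable (fun z => Real.log (auxR p f β β' z)) (modelLaw p f β')
  swap
  · rw [integral_undef hint]
    exact hC
  have hle := aux_lintegral_R p m L hm0 hm1 f hfm hfb hflip β β'
  have hnn : 0 ≤ᵐ[modelLaw p f β'] auxR p f β β' := by
    filter_upwards [hpos] with z h using h.le
  have hRi : Integrable (auxR p f β β') (modelLaw p f β') := by
    refine ⟨hRm.aestronglyMeasurable, ?_⟩
    rw [hasFiniteIntegral_iff_ofReal hnn]
    exact hle.trans_lt ENNReal.ofReal_lt_top
  have hRint : ∫ z, auxR p f β β' z ∂(modelLaw p f β') ≤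
      1 + L ^ 2 * (∑ i, (β i - β' i) ^ 2) / (m * (1 - m)) := by
    rw [integral_eq_lintegral_of_nonneg_ae hnn hRm.aestronglyMeasurable]
    exact ENNReal.toReal_le_of_le_ofReal (by positivity) hle
  have hmono : ∫ z, Real.log (auxR p f β β' z) ∂(modelLaw p f β') ≤
      ∫ z, (auxR p f β β' z - 1) ∂(modelLaw p f β') := by
    refine integral_mono_ae hint (hRi.sub (integrable_const _)) ?_
    filter_upwards [hpos] with z h using Real.log_le_sub_one_of_pos h
  rw [integral_sub hRi (integrable_const _)] at hmono
  simp only [integral_const, probReal_univ, smul_eq_mul, mul_one] at hmono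
  linarith
end
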